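/- arXiv:math/0104260 — 6 statements merged into one kernel-verified Lean document; each statement's English description precedes it below -/
import Mathlib

section
/- For every real number q with 0 ≤ q < 1 and every natural number n, the q-Gamma function value Γ_q(n+1), defined by Γ_q(n+1) = ((q;q)_∞ / (1-q)^n) · ∑_{j=0}^∞ q^{(n+1)j} / (q;q)_j, equals the q-factorial [n]_q!. Equivalently, (q;q)_∞ · ∑_{j=0}^∞ q^{(n+1)j} / (q;q)_j = (1-q)^n · [n]_q!. -/
/-- The q-integer `[n]_q = 1 + q + ⋯ + q^(n-1)`. -/
noncomputable def qInt (q : ℝ) (n : ℕ) : ℝ := ∑ i ∈ Finset.range n, q ^ i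

/-- The q-factorial `[n]_q! = [1]_q ⋯ [n]_q`. -/
noncomputable def qFact (q : ℝ) (n : ℕ) : ℝ := ∏ i ∈ Finset.range n, qInt q (i + 1)

/-- The q-Pochhammer symbol `(a;q)_n = ∏_{j=0}^{n-1} (1 - a q^j)`. -/
noncomputable def qPoch (a q : ℝ) (n : ℕ) : ℝ := ∏ j ∈ Finset.range n, (1 - a * q ^ j)

/-- The infinite q-Pochhammer symbol `(a;q)_∞ = ∏_{j=0}^{∞} (1 - a q^j)`. -/
noncomputable def qPochInf (a q : ℝ) : ℝ := ∏' j : ℕ, (1 - a * q ^ j)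

lemma qPoch_succ (a q : ℝ) (n : ℕ) : qPoch a q (n + 1) = qPoch a q n * (1 - a * q ^ n) :=
  Finset.prod_range_succ _ _

lemma one_sub_mul_pow_pos {q : ℝ} (hq0 : 0 ≤ q) (hq1 : q < 1) (n : ℕ) : 0 < 1 - q * q ^ n := by
  rw [← pow_succ', sub_pos]
  exact pow_lt_one₀ hq0 hq1 n.succ_ne_zero

lemma qPoch_self_pos {q : ℝ} (hq0 : 0 ≤ q) (hq1 : q < 1) (n : ℕ) : 0 < qPoch q q n :=
  Finset.prod_pos fun j _ => one_sub_mul_pow_pos hq0 hq1 j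

lemma qPoch_self_eq (q : ℝ) (n : ℕ) : qPoch q q n = (1 - q) ^ n * qFact q n := by
  have h (i : ℕ) : 1 - q * q ^ i = (1 - q) * qInt q (i + 1) := by
    rw [qInt, mul_neg_geom_sum, pow_succ']
  simp only [qPoch, qFact, h, Finset.prod_mul_distrib, Finset.prod_const, Finset.card_range]

lemma tendsto_qPoch_qPochInf (a : ℝ) {q : ℝ} (hq0 : 0 ≤ q) (hq1 : q < 1) :
    Filter.Tendsto (qPoch a q) Filter.atTop (nhds (qPochInf a q)) := by
  have hs : Summable fun j : ℕ => ‖-(a * q ^ j)‖ :=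
    (((summable_geometric_of_lt_one hq0 hq1).mul_left a).neg).norm
  simpa only [← sub_eq_add_neg, qPochInf] using!
    (multipliable_one_add_of_summable hs).hasProd.tendsto_prod_nat

lemma summable_pow_div_qPoch {q z : ℝ} (hq0 : 0 ≤ q) (hq1 : q < 1) (hz0 : 0 ≤ z) (hz1 : z < 1) :
    Summable fun j : ℕ => z ^ j / qPoch q q j := by
  obtain ⟨r, hzr, hr1⟩ := exists_between hz1
  have hlim : Filter.Tendsto (fun j : ℕ => z / (1 - q * q ^ j)) Filter.atTop (nhds z) := by
    have h := (tendsto_pow_atTop_nhds_zero_of_lt_one hq0 hq1).const_mul q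
    simpa [Pi.div_def] using (tendsto_const_nhds (x := z)).div (h.const_sub 1) (by simp)
  refine summable_of_ratio_norm_eventually_le hr1 ?_
  filter_upwards [hlim.eventually_le_const hzr] with j hj
  have hP := qPoch_self_pos hq0 hq1
  rw [Real.norm_of_nonneg (div_nonneg (pow_nonneg hz0 _) (hP _).le),
    Real.norm_of_nonneg (div_nonneg (pow_nonneg hz0 _) (hP _).le), qPoch_succ, pow_succ',
    mul_comm (qPoch q q j), mul_div_mul_comm]
  exact mul_le_mul_of_nonneg_right hj (div_nonneg (pow_nonneg hz0 _) (hP _).le)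

lemma tsum_mul_pow_div_qPoch {q z : ℝ} (hq0 : 0 ≤ q) (hq1 : q < 1) (hz0 : 0 ≤ z) (hz1 : z < 1) :
    ∑' j : ℕ, (q * z) ^ j / qPoch q q j = (1 - z) * ∑' j : ℕ, z ^ j / qPoch q q j := by
  have hs := summable_pow_div_qPoch hq0 hq1 hz0 hz1
  have hs' := summable_pow_div_qPoch hq0 hq1 (mul_nonneg hq0 hz0)
    (mul_lt_one_of_nonneg_of_lt_one_left hq0 hq1 hz1.le)
  have hterm (j : ℕ) : (q * z) ^ (j + 1) / qPoch q q (j + 1)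
      = z ^ (j + 1) / qPoch q q (j + 1) - z * (z ^ j / qPoch q q j) := by
    have h1 := (qPoch_self_pos hq0 hq1 j).ne'
    have h2 := (one_sub_mul_pow_pos hq0 hq1 j).ne'
    rw [qPoch_succ]
    field_simp
    ring
  rw [hs'.tsum_eq_zero_add, sub_mul, one_mul, tsum_congr hterm,
    ((summable_nat_add_iff 1).2 hs).tsum_sub (hs.mul_left z), tsum_mul_left]
  have h := hs.tsum_eq_zero_add
  rw [pow_zero] at h ⊢
  linear_combination -h

lemma tsum_pow_succ_div_qPoch {q : ℝ} (hq0 : 0 ≤ q) (hq1 : q < 1) (n : ℕ) :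
    ∑' j : ℕ, (q ^ (n + 1)) ^ j / qPoch q q j
      = qPoch q q n * ∑' j : ℕ, q ^ j / qPoch q q j := by
  induction n with
  | zero => simp [qPoch]
  | succ n ih =>
    rw [pow_succ' q (n + 1), tsum_mul_pow_div_qPoch hq0 hq1 (pow_nonneg hq0 _)
      (pow_lt_one₀ hq0 hq1 n.succ_ne_zero), ih, qPoch_succ, pow_succ' q n]
    ring

lemma tendsto_tsum_pow_succ_div_qPoch {q : ℝ} (hq0 : 0 ≤ q) (hq1 : q < 1) :
    Filter.Tendsto (fun n : ℕ => ∑' j : ℕ, (q ^ (n + 1)) ^ j / qPoch q q j)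
      Filter.atTop (nhds 1) := by
  rw [← tsum_ite_eq (0 : ℕ) (fun _ => (1 : ℝ))]
  refine tendsto_tsum_of_dominated_convergence (summable_pow_div_qPoch hq0 hq1 hq0 hq1) ?_ ?_
  · rintro (_ | j)
    · simp [qPoch]
    · have h := (tendsto_pow_atTop_nhds_zero_of_lt_one (pow_nonneg hq0 (j + 1))
        (pow_lt_one₀ hq0 hq1 j.succ_ne_zero)).comp (Filter.tendsto_add_atTop_nat 1)
      simpa [pow_right_comm q _ (j + 1)] using h.div_const (qPoch q q (j + 1))
  · refine Filter.Eventually.of_forall fun n j => ?_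
    have hP := qPoch_self_pos hq0 hq1 j
    rw [Real.norm_of_nonneg (by positivity)]
    gcongr
    exact pow_le_of_le_one hq0 hq1.le n.succ_ne_zero

/-- The case `z = q` of Euler's identity `(z;q)_∞ ∑ z^j / (q;q)_j = 1`. -/
lemma qPochInf_mul_tsum_eq_one {q : ℝ} (hq0 : 0 ≤ q) (hq1 : q < 1) :
    qPochInf q q * ∑' j : ℕ, q ^ j / qPoch q q j = 1 := by
  refine tendsto_nhds_unique ((tendsto_qPoch_qPochInf q hq0 hq1).mul_const _) ?_
  simpa only [tsum_pow_succ_div_qPoch hq0 hq1] using tendsto_tsum_pow_succ_div_qPoch hq0 hq1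

/-- `Γ_q(n+1) = [n]_q!`, i.e.
`(q;q)_∞ · ∑_{j=0}^∞ q^{(n+1)j}/(q;q)_j = (1-q)^n · [n]_q!`. -/
theorem qGamma_eq_qFact (q : ℝ) (hq0 : 0 ≤ q) (hq1 : q < 1) (n : ℕ) :
    qPochInf q q * ∑' j : ℕ, q ^ ((n + 1) * j) / qPoch q q j
      = (1 - q) ^ n * qFact q n := by
  simp only [pow_mul]
  rw [tsum_pow_succ_div_qPoch hq0 hq1, mul_left_comm, qPochInf_mul_tsum_eq_one hq0 hq1, mul_one,
    qPoch_self_eq]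
end

section
/- Let 0 ≤ q < 1 and β > 0, and let r_j = q^{j/2}·√(β/(1-q)). For every sequence (a_n) of complex numbers, the following identity holds in [0, ∞] (both sides may be infinite): (q;q)_∞ · ∑_{j=0}^∞ (q^j/(q;q)_j) · ∑_{n=0}^∞ |a_n|² · r_j^{2n} = ∑_{n=0}^∞ β^n · [n]_q! · |a_n|². Hence the Segal–Bargmann correspondence (a_n) ↦ ∑_n a_n z^n is norm-preserving between the weighted ℓ²-space with weights β^n[n]_q! and L²(ν_q). -/
/-- The radius `r_j = q^{j/2} √(β/(1-q))`. -/
noncomputable def rRad (q β : ℝ) (j : ℕ) : ℝ := Real.sqrt (q ^ j) * Real.sqrt (β / (1 - q))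

lemma qPoch_self_succ (q : ℝ) (n : ℕ) : qPoch q q (n + 1) = qPoch q q n * (1 - q ^ (n + 1)) := by
  rw [qPoch, Finset.prod_range_succ, ← pow_succ']
  rfl

lemma summable_norm_neg_mul_pow {q : ℝ} (hq0 : 0 ≤ q) (hq1 : q < 1) :
    Summable fun j : ℕ => ‖-(q * q ^ j)‖ := by
  simpa [abs_of_nonneg hq0] using (summable_geometric_of_lt_one hq0 hq1).mul_left q

lemma tendsto_qPoch_self {q : ℝ} (hq0 : 0 ≤ q) (hq1 : q < 1) :
    Filter.Tendsto (qPoch q q) Filter.atTop (nhds (qPochInf q q)) := by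
  have h := multipliable_one_add_of_summable (summable_norm_neg_mul_pow hq0 hq1)
  simp only [← sub_eq_add_neg] at h
  exact h.hasProd.tendsto_prod_nat

lemma qPochInf_self_pos {q : ℝ} (hq0 : 0 ≤ q) (hq1 : q < 1) : 0 < qPochInf q q := by
  have hne : qPochInf q q ≠ 0 := by
    have h := tprod_one_add_ne_zero_of_summable (f := fun j : ℕ => -(q * q ^ j)) (fun j => by
      rw [← sub_eq_add_neg, ← pow_succ']
      exact (sub_pos.2 (pow_lt_one₀ hq0 hq1 j.succ_ne_zero)).ne')
      (summable_norm_neg_mul_pow hq0 hq1)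
    simpa [qPochInf, sub_eq_add_neg] using h
  refine lt_of_le_of_ne ?_ hne.symm
  exact ge_of_tendsto' (tendsto_qPoch_self hq0 hq1) fun n => (qPoch_self_pos hq0 hq1 n).le

lemma sum_range_pow_div_qPoch {q : ℝ} (hq0 : 0 ≤ q) (hq1 : q < 1) (n : ℕ) :
    ∑ j ∈ Finset.range (n + 1), q ^ j / qPoch q q j = (qPoch q q n)⁻¹ := by
  induction n with
  | zero => simp [qPoch]
  | succ n ih =>
    have h0 := (qPoch_self_pos hq0 hq1 n).ne'
    have h1 : 1 - q ^ (n + 1) ≠ 0 := (sub_pos.2 (pow_lt_one₀ hq0 hq1 n.succ_ne_zero)).ne'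
    rw [Finset.sum_range_succ, ih, qPoch_self_succ]
    field_simp
    ring

/-- Euler's identity `∑_j z^j / (q;q)_j = 1 / (z;q)_∞` at `z = q^(n+1)`. -/
lemma hasSum_pow_div_qPoch {q : ℝ} (hq0 : 0 ≤ q) (hq1 : q < 1) (n : ℕ) :
    HasSum (fun j : ℕ => (q ^ j) ^ (n + 1) / qPoch q q j) (qPoch q q n / qPochInf q q) := by
  induction n with
  | zero =>
    have hnn : ∀ j : ℕ, 0 ≤ (q ^ j) ^ (0 + 1) / qPoch q q j := fun j =>
      div_nonneg (by positivity) (qPoch_self_pos hq0 hq1 j).le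
    rw [hasSum_iff_tendsto_nat_of_nonneg hnn, ← Filter.tendsto_add_atTop_iff_nat 1]
    simp only [zero_add, pow_one, sum_range_pow_div_qPoch hq0 hq1]
    simpa [qPoch] using (tendsto_qPoch_self hq0 hq1).inv₀ (qPochInf_self_pos hq0 hq1).ne'
  | succ n ih =>
    have hshift : HasSum (fun j : ℕ => (q ^ j) ^ (n + 1) / qPoch q q j * (1 - q ^ j))
        (q ^ (n + 1) * (qPoch q q n / qPochInf q q)) := by
      rw [← hasSum_nat_add_iff' 1]
      simp only [Finset.range_one, Finset.sum_singleton, pow_zero, sub_self, mul_zero, sub_zero]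
      refine (ih.mul_left (q ^ (n + 1))).congr_fun fun j => ?_
      have h0 := (qPoch_self_pos hq0 hq1 j).ne'
      have h1 : 1 - q ^ (j + 1) ≠ 0 := (sub_pos.2 (pow_lt_one₀ hq0 hq1 j.succ_ne_zero)).ne'
      rw [qPoch_self_succ, pow_succ q j, mul_pow]
      rw [pow_succ q j] at h1
      field_simp
    have hval : qPoch q q (n + 1) / qPochInf q q =
        qPoch q q n / qPochInf q q - q ^ (n + 1) * (qPoch q q n / qPochInf q q) := by
      rw [qPoch_self_succ]
      ring
    rw [hval]
    exact (ih.sub hshift).congr_fun fun j => by ring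

lemma rRad_pow_two_mul {q β : ℝ} (hq0 : 0 ≤ q) (hq1 : q < 1) (hβ : 0 < β) (j n : ℕ) :
    rRad q β j ^ (2 * n) = (q ^ j) ^ n * (β / (1 - q)) ^ n := by
  rw [rRad, pow_mul, mul_pow, Real.sq_sqrt (by positivity),
    Real.sq_sqrt (div_nonneg hβ.le (sub_nonneg.2 hq1.le)), mul_pow]

/-- The Segal–Bargmann correspondence `(a_n) ↦ ∑_n a_n z^n` is norm-preserving,
as an identity in `[0,∞]`:
`(q;q)_∞ ∑_j (q^j/(q;q)_j) ∑_n |a_n|² r_j^{2n} = ∑_n β^n [n]_q! |a_n|²`. -/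
theorem segalBargmann_norm_preserving (q β : ℝ) (hq0 : 0 ≤ q) (hq1 : q < 1)
    (hβ : 0 < β) (a : ℕ → ℂ) :
    ENNReal.ofReal (qPochInf q q) *
      ∑' j : ℕ, ENNReal.ofReal (q ^ j / qPoch q q j) *
        ∑' n : ℕ, ENNReal.ofReal (‖a n‖ ^ 2 * rRad q β j ^ (2 * n))
      = ∑' n : ℕ, ENNReal.ofReal (β ^ n * qFact q n * ‖a n‖ ^ 2) := by
  have hP := qPochInf_self_pos hq0 hq1
  simp_rw [← ENNReal.tsum_mul_left]
  rw [ENNReal.tsum_comm]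
  refine tsum_congr fun n => ?_
  have h1q : 0 < 1 - q := sub_pos.2 hq1
  have hS := ((hasSum_pow_div_qPoch hq0 hq1 n).mul_left
    (qPochInf q q * (‖a n‖ ^ 2 * (β / (1 - q)) ^ n)))
  have hnn : ∀ j : ℕ, 0 ≤ qPochInf q q * (‖a n‖ ^ 2 * (β / (1 - q)) ^ n) *
      ((q ^ j) ^ (n + 1) / qPoch q q j) := fun j => by
    have := qPoch_self_pos hq0 hq1 j
    positivity
  have hval : β ^ n * qFact q n * ‖a n‖ ^ 2 = qPochInf q q *
      (‖a n‖ ^ 2 * (β / (1 - q)) ^ n) * (qPoch q q n / qPochInf q q) := by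
    rw [qPoch_self_eq, div_pow]
    field_simp
  rw [hval, ← hS.tsum_eq, ENNReal.ofReal_tsum_of_nonneg hnn hS.summable]
  refine tsum_congr fun j => ?_
  have hj := qPoch_self_pos hq0 hq1 j
  rw [← ENNReal.ofReal_mul (by positivity), ← ENNReal.ofReal_mul hP.le,
    rRad_pow_two_mul hq0 hq1 hβ]
  congr 1
  ring
end

section
/- Let 0 ≤ q < 1 and β > 0, and let (a_n) be a sequence of complex numbers with M² := ∑_{n=0}^∞ β^n · [n]_q! · |a_n|² < ∞. Then for every complex number z with |z|² < β/(1-q), the series ∑_{n=0}^∞ a_n z^n converges absolutely, and moreover ∑_{n=0}^∞ |a_n z^n| ≤ M · √(exp_q(|z|²/β)) ≤ M · exp_q(|z|²/β). -/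
/-- The q-exponential `exp_q(x) = ∑_{n=0}^∞ x^n/[n]_q!`. -/
noncomputable def qExp (q x : ℝ) : ℝ := ∑' n : ℕ, x ^ n / qFact q n

theorem one_le_qInt_succ {q : ℝ} (hq0 : 0 ≤ q) (n : ℕ) : 1 ≤ qInt q (n + 1) := by
  rw [qInt, Finset.sum_range_succ', pow_zero]
  exact le_add_of_nonneg_left (Finset.sum_nonneg fun i _ => pow_nonneg hq0 _)

theorem qFact_pos {q : ℝ} (hq0 : 0 ≤ q) (n : ℕ) : 0 < qFact q n :=
  Finset.prod_pos fun i _ => one_pos.trans_le (one_le_qInt_succ hq0 i)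

theorem tendsto_qInt {q : ℝ} (hq0 : 0 ≤ q) (hq1 : q < 1) :
    Filter.Tendsto (qInt q) Filter.atTop (nhds (1 - q)⁻¹) :=
  (hasSum_geometric_of_lt_one hq0 hq1).tendsto_sum_nat

/-- The q-exponential series converges on `[0, 1/(1-q))`. -/
theorem summable_pow_div_qFact {q x : ℝ} (hq0 : 0 ≤ q) (hq1 : q < 1) (hx0 : 0 ≤ x)
    (hx : x * (1 - q) < 1) : Summable fun n : ℕ => x ^ n / qFact q n := by
  obtain ⟨r, hxr, hr1⟩ := exists_between hx
  have hlim : Filter.Tendsto (fun n : ℕ => x / qInt q (n + 1)) Filter.atTop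
      (nhds (x * (1 - q))) := by
    have h := (tendsto_const_nhds (x := x)).div
      ((tendsto_qInt hq0 hq1).comp (Filter.tendsto_add_atTop_nat 1))
      (inv_ne_zero (sub_pos.2 hq1).ne')
    rwa [div_inv_eq_mul] at h
  refine summable_of_ratio_norm_eventually_le hr1 ?_
  filter_upwards [hlim.eventually_le_const hxr] with n hn
  have hterm : 0 ≤ x ^ n / qFact q n := div_nonneg (pow_nonneg hx0 n) (qFact_pos hq0 n).le
  have hsucc : x ^ (n + 1) / qFact q (n + 1) = x / qInt q (n + 1) * (x ^ n / qFact q n) := by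
    rw [qFact, Finset.prod_range_succ, ← qFact, pow_succ', mul_comm (qFact q n),
      mul_div_mul_comm]
  rw [hsucc, norm_mul, Real.norm_of_nonneg hterm,
    Real.norm_of_nonneg (div_nonneg hx0 (zero_le_one.trans (one_le_qInt_succ hq0 n)))]
  exact mul_le_mul_of_nonneg_right hn hterm

theorem one_le_qExp {q x : ℝ} (hq0 : 0 ≤ q) (hq1 : q < 1) (hx0 : 0 ≤ x)
    (hx : x * (1 - q) < 1) : 1 ≤ qExp q x := by
  have h := (summable_pow_div_qFact hq0 hq1 hx0 hx).le_tsum 0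
    fun n _ => div_nonneg (pow_nonneg hx0 n) (qFact_pos hq0 n).le
  simpa [qExp, qFact] using h

/-- The Cauchy–Schwarz inequality for nonnegative real series. -/
theorem summable_mul_and_tsum_mul_le_sqrt_mul_sqrt {f g : ℕ → ℝ} (hf : ∀ n, 0 ≤ f n)
    (hg : ∀ n, 0 ≤ g n) (hf2 : Summable fun n => f n ^ 2) (hg2 : Summable fun n => g n ^ 2) :
    (Summable fun n => f n * g n) ∧
      ∑' n, f n * g n ≤ Real.sqrt (∑' n, f n ^ 2) * Real.sqrt (∑' n, g n ^ 2) := by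
  have h := Real.summable_and_inner_le_Lp_mul_Lq_tsum_of_nonneg Real.HolderConjugate.two_two hf hg
    (by simpa using hf2) (by simpa using hg2)
  simpa [Real.sqrt_eq_rpow] using h

/-- Absolute convergence of the Segal–Bargmann transform on `Ω_q^β` with the
estimate `∑ |a_n z^n| ≤ M √(exp_q(|z|²/β)) ≤ M exp_q(|z|²/β)` where
`M² = ∑ β^n [n]_q! |a_n|²`. -/
theorem segalBargmann_abs_convergent (q β : ℝ) (hq0 : 0 ≤ q) (hq1 : q < 1)
    (hβ : 0 < β) (a : ℕ → ℂ)
    (hsum : Summable (fun n : ℕ => β ^ n * qFact q n * ‖a n‖ ^ 2))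
    (M : ℝ) (hM : M = Real.sqrt (∑' n : ℕ, β ^ n * qFact q n * ‖a n‖ ^ 2))
    (z : ℂ) (hz : ‖z‖ ^ 2 < β / (1 - q)) :
    Summable (fun n : ℕ => ‖a n * z ^ n‖) ∧
    (∑' n : ℕ, ‖a n * z ^ n‖) ≤ M * Real.sqrt (qExp q (‖z‖ ^ 2 / β)) ∧
    M * Real.sqrt (qExp q (‖z‖ ^ 2 / β)) ≤ M * qExp q (‖z‖ ^ 2 / β) := by
  have hx0 : 0 ≤ ‖z‖ ^ 2 / β := by positivity
  have hx : ‖z‖ ^ 2 / β * (1 - q) < 1 := by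
    rw [lt_div_iff₀ (sub_pos.2 hq1)] at hz
    rwa [div_mul_eq_mul_div, div_lt_one hβ]
  have hfact := qFact_pos hq0
  have hf2 (n : ℕ) : (Real.sqrt (β ^ n * qFact q n) * ‖a n‖) ^ 2 =
      β ^ n * qFact q n * ‖a n‖ ^ 2 := by
    rw [mul_pow, Real.sq_sqrt (mul_nonneg (pow_nonneg hβ.le n) (hfact n).le)]
  have hg2 (n : ℕ) : (‖z‖ ^ n / Real.sqrt (β ^ n * qFact q n)) ^ 2 =
      (‖z‖ ^ 2 / β) ^ n / qFact q n := by
    rw [div_pow, Real.sq_sqrt (mul_nonneg (pow_nonneg hβ.le n) (hfact n).le), div_pow,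
      div_div, pow_right_comm]
  have hfg (n : ℕ) : Real.sqrt (β ^ n * qFact q n) * ‖a n‖ *
      (‖z‖ ^ n / Real.sqrt (β ^ n * qFact q n)) = ‖a n * z ^ n‖ := by
    have hne := (Real.sqrt_pos.2 (mul_pos (pow_pos hβ n) (hfact n))).ne'
    rw [norm_mul, norm_pow]
    field_simp
  have hCS := summable_mul_and_tsum_mul_le_sqrt_mul_sqrt
    (f := fun n => Real.sqrt (β ^ n * qFact q n) * ‖a n‖)
    (g := fun n => ‖z‖ ^ n / Real.sqrt (β ^ n * qFact q n))
    (fun n => by positivity) (fun n => by positivity) (by simpa only [hf2] using hsum)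
    (by simpa only [hg2] using summable_pow_div_qFact hq0 hq1 hx0 hx)
  simp only [hf2, hg2, hfg] at hCS
  rw [← hM] at hCS
  refine ⟨hCS.1, hCS.2, mul_le_mul_of_nonneg_left ?_ (hM ▸ Real.sqrt_nonneg _)⟩
  have h1 := one_le_qExp hq0 hq1 hx0 hx
  exact Real.sqrt_le_iff.2 ⟨by linarith, by nlinarith⟩
end

section
/- Let 0 ≤ q < 1 and β > 0. For every n ≥ 0 and every complex z ≠ 0, the factorization (Z_q + D_{q,β} + α̃_{N_q})(z^n) = ((1/√β)·Z_q + √β·I)((1/√β)·D_{q,β} + √β·I)(z^n) holds; explicitly, both sides equal z^{n+1} + β·[n]_q·z^{n-1} + ([n]_q + β)·z^n. -/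
/-- The q-creation operator `(Z_q F)(z) = z F(z)`. -/
noncomputable def Zq (F : ℂ → ℂ) : ℂ → ℂ := fun z => z * F z

/-- The q-annihilation operator `(D_{q,β} F)(z) = β (F(z) - F(qz)) / (z(1-q))`. -/
noncomputable def Dq (q β : ℝ) (F : ℂ → ℂ) : ℂ → ℂ :=
  fun z => (β : ℂ) * (F z - F ((q : ℂ) * z)) / (z * ((1 : ℂ) - (q : ℂ)))

/-- The operator `((1/√β) Z_q + √β I)((1/√β) D_{q,β} + √β I)` applied to a
function `F`. -/
noncomputable def factorizedOp (q β : ℝ) (F : ℂ → ℂ) : ℂ → ℂ :=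
  fun z =>
    ((1 : ℂ) / (Real.sqrt β : ℂ)) *
        Zq (fun w => ((1 : ℂ) / (Real.sqrt β : ℂ)) * Dq q β F w
              + (Real.sqrt β : ℂ) * F w) z
      + (Real.sqrt β : ℂ) *
        (((1 : ℂ) / (Real.sqrt β : ℂ)) * Dq q β F z + (Real.sqrt β : ℂ) * F z)

/-- The geometric sum `(1 - q) [n]_q = 1 - q ^ n`, over `ℂ`. -/
theorem one_sub_mul_qInt (q : ℝ) (n : ℕ) :
    ((1 : ℂ) - (q : ℂ)) * (qInt q n : ℂ) = 1 - (q : ℂ) ^ n := by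
  rw [qInt]
  push_cast
  exact mul_neg_geom_sum (q : ℂ) n

/-- `D_{q,β} z^n = β [n]_q z^(n-1)`. -/
theorem Dq_pow {q : ℝ} (β : ℝ) (hq : q ≠ 1) (n : ℕ) {z : ℂ} (hz : z ≠ 0) :
    Dq q β (fun w => w ^ n) z = (β : ℂ) * (qInt q n : ℂ) * z ^ (n - 1) := by
  have hq' : (1 : ℂ) - (q : ℂ) ≠ 0 := sub_ne_zero.mpr (by exact_mod_cast hq.symm)
  cases n with
  | zero => simp [Dq, qInt]
  | succ m =>
    rw [Dq, div_eq_iff (mul_ne_zero hz hq'), Nat.add_sub_cancel, mul_pow]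
    linear_combination -(β : ℂ) * z ^ (m + 1) * one_sub_mul_qInt q (m + 1)

/-- The factorization
`Z_q + D_{q,β} + α̃_{N_q} = ((1/√β) Z_q + √β I)((1/√β) D_{q,β} + √β I)` on
monomials: both sides equal `z^{n+1} + β [n]_q z^{n-1} + ([n]_q + β) z^n`. -/
theorem factorization_on_monomials (q β : ℝ) (hq0 : 0 ≤ q) (hq1 : q < 1)
    (hβ : 0 < β) (n : ℕ) (z : ℂ) (hz : z ≠ 0) :
    Zq (fun w => w ^ n) z + Dq q β (fun w => w ^ n) z
        + ((qInt q n : ℝ) + β : ℝ) * z ^ n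
      = factorizedOp q β (fun w => w ^ n) z ∧
    factorizedOp q β (fun w => w ^ n) z
      = z ^ (n + 1) + (β : ℂ) * (qInt q n : ℂ) * z ^ (n - 1)
          + ((qInt q n : ℝ) + β : ℝ) * z ^ n := by
  have hD := Dq_pow β hq1.ne n hz
  have hpow : z * ((qInt q n : ℂ) * z ^ (n - 1)) = (qInt q n : ℂ) * z ^ n := by
    cases n with
    | zero => simp [qInt]
    | succ m => rw [Nat.add_sub_cancel]; ring
  have hs : (Real.sqrt β : ℂ) ^ 2 = (β : ℂ) := by
    exact_mod_cast Real.sq_sqrt hβ.le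
  have hs0 : (Real.sqrt β : ℂ) ≠ 0 := by
    exact_mod_cast (Real.sqrt_pos.mpr hβ).ne'
  have hfac : factorizedOp q β (fun w => w ^ n) z
      = z ^ (n + 1) + (β : ℂ) * (qInt q n : ℂ) * z ^ (n - 1)
          + ((qInt q n : ℝ) + β : ℝ) * z ^ n := by
    simp only [factorizedOp, Zq, hD]
    push_cast
    rw [← hs]
    field_simp
    linear_combination hpow
  refine ⟨?_, hfac⟩
  rw [hfac, hD, Zq]
  ring
end

section
/- Let 0 ≤ q < 1 and β > 0. Let (C_n^{(q)}) be the q-Charlier polynomials defined by C_0^{(q)} = 1, C_1^{(q)} = X − β, and C_{n+1}^{(q)} = (X − [n]_q − β)·C_n^{(q)} − β·[n]_q·C_{n−1}^{(q)} for n ≥ 1, and let S be the unique linear map on real polynomials sending C_n^{(q)} to X^n for every n (well-defined since C_n^{(q)} is monic of degree n). Let D_{q,β} be the linear operator on polynomials with D_{q,β}(X^n) = β·[n]_q·X^{n−1} for n ≥ 1 and D_{q,β}(1) = 0 (i.e., D_{q,β}p = (β/(1−q))·(p(X) − p(qX))/X), let Z_q be multiplication by X, and let α̃_{N_q} be the linear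 operator with α̃_{N_q}(X^n) = ([n]_q + β)·X^n. Then for every real polynomial p: S(X·p) = D_{q,β}(S p) + Z_q(S p) + α̃_{N_q}(S p). That is, the Segal–Bargmann transform intertwines the multiplication operator by x in L²(μ_p^{(q)}) with the sum of the q-annihilation, q-creation, and α̃_{N_q} operators. -/
open Polynomial

/-- The q-Charlier polynomials: `C_0 = 1`, `C_1 = X - β`,
`C_{n+1} = (X - [n]_q - β) C_n - β [n]_q C_{n-1}`. -/
noncomputable def qCharlier (q β : ℝ) : ℕ → Polynomial ℝ
  | 0 => 1
  | 1 => X - C β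
  | (n + 2) =>
      (X - C (qInt q (n + 1) + β)) * qCharlier q β (n + 1)
        - C (β * qInt q (n + 1)) * qCharlier q β n

/-- Multiplication by `X` acts on the q-Charlier polynomials by the three-term recurrence. -/
theorem X_mul_qCharlier_succ (q β : ℝ) (n : ℕ) :
    X * qCharlier q β (n + 1) = qCharlier q β (n + 2)
      + (qInt q (n + 1) + β) • qCharlier q β (n + 1)
      + (β * qInt q (n + 1)) • qCharlier q β n := by
  rw [qCharlier, smul_eq_C_mul, smul_eq_C_mul]
  ring

theorem X_mul_qCharlier_zero (q β : ℝ) :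
    X * qCharlier q β 0 = qCharlier q β 1 + β • qCharlier q β 0 := by
  simp [qCharlier, smul_eq_C_mul]

/-- The q-Charlier polynomials span the space of real polynomials. -/
theorem span_range_qCharlier (q β : ℝ) :
    Submodule.span ℝ (Set.range (qCharlier q β)) = ⊤ := by
  set W := Submodule.span ℝ (Set.range (qCharlier q β))
  have mem (n : ℕ) : qCharlier q β n ∈ W := Submodule.subset_span ⟨n, rfl⟩
  have X_mul_mem : W ≤ W.comap (LinearMap.mulLeft ℝ X) := by
    refine Submodule.span_le.2 ?_
    rintro _ ⟨_ | n, rfl⟩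
    · change X * _ ∈ W
      rw [X_mul_qCharlier_zero]
      exact W.add_mem (mem 1) (W.smul_mem _ (mem 0))
    · change X * _ ∈ W
      rw [X_mul_qCharlier_succ]
      exact W.add_mem (W.add_mem (mem _) (W.smul_mem _ (mem _))) (W.smul_mem _ (mem _))
  have X_pow_mem (n : ℕ) : (X : Polynomial ℝ) ^ n ∈ W := by
    induction n with
    | zero => simpa [qCharlier] using mem 0
    | succ n ih => rw [pow_succ']; exact X_mul_mem ih
  refine eq_top_iff.2 fun p _ => ?_
  rw [p.as_sum_range_C_mul_X_pow]
  refine W.sum_mem fun i _ => ?_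
  rw [← smul_eq_C_mul]
  exact W.smul_mem _ (X_pow_mem i)

/-- The Segal–Bargmann transform `S` (sending `C_n^{(q)}` to `X^n`) intertwines
multiplication by `x` with `D_{q,β} + Z_q + α̃_{N_q}`:
`S(X p) = D_{q,β}(S p) + Z_q(S p) + α̃_{N_q}(S p)`. -/
theorem segalBargmann_intertwines_multiplication_charlier (q β : ℝ)
    (hq0 : 0 ≤ q) (hq1 : q < 1) (hβ : 0 < β)
    (S : Polynomial ℝ →ₗ[ℝ] Polynomial ℝ)
    (hS : ∀ n : ℕ, S (qCharlier q β n) = X ^ n)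
    (D : Polynomial ℝ →ₗ[ℝ] Polynomial ℝ)
    (hD0 : D 1 = 0)
    (hD : ∀ n : ℕ, D (X ^ (n + 1)) = C (β * qInt q (n + 1)) * X ^ n)
    (Z : Polynomial ℝ →ₗ[ℝ] Polynomial ℝ)
    (hZ : ∀ p : Polynomial ℝ, Z p = X * p)
    (A : Polynomial ℝ →ₗ[ℝ] Polynomial ℝ)
    (hA : ∀ n : ℕ, A (X ^ n) = C (qInt q n + β) * X ^ n) :
    ∀ p : Polynomial ℝ, S (X * p) = D (S p) + Z (S p) + A (S p) := by
  intro p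
  have eq_maps : S ∘ₗ LinearMap.mulLeft ℝ X = D ∘ₗ S + Z ∘ₗ S + A ∘ₗ S := by
    refine LinearMap.ext_on_range (span_range_qCharlier q β) fun n => ?_
    simp only [LinearMap.add_apply, LinearMap.comp_apply, LinearMap.mulLeft_apply, hS, hZ, hA]
    cases n with
    | zero =>
      rw [X_mul_qCharlier_zero, map_add, map_smul, hS, hS, pow_zero, hD0, smul_eq_C_mul]
      simp [qInt]
    | succ n =>
      rw [X_mul_qCharlier_succ, map_add, map_add, map_smul, map_smul, hS, hS, hS, hD,
        smul_eq_C_mul, smul_eq_C_mul]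
      ring
  exact LinearMap.congr_fun eq_maps p
end

section
/- Let 0 ≤ q < 1 and β > 0. Let (H_n^{(q)}) be the q-Hermite polynomials defined by H_0^{(q)} = 1, H_1^{(q)} = X, and H_{n+1}^{(q)} = X·H_n^{(q)} − β·[n]_q·H_{n−1}^{(q)} for n ≥ 1, and let S be the unique linear map on real polynomials sending H_n^{(q)} to X^n for every n (well-defined since H_n^{(q)} is monic of degree n). Let D_{q,β} be the linear operator on polynomials with D_{q,β}(X^n) = β·[n]_q·X^{n−1} for n ≥ 1 and D_{q,β}(1) = 0, and let Z_q be multiplication by X. Then for every real polynomial p: S(X·p) = D_{q,β}(S p) + Z_q(S p). That is, in the q-Gaussian case the Segal–Bargmann transform intertwines the multiplication operator by x with the sum of the q-annihilation and q-creation operators. -/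
open Polynomial

/-- The q-Hermite polynomials: `H_0 = 1`, `H_1 = X`,
`H_{n+1} = X H_n - β [n]_q H_{n-1}`. -/
noncomputable def qHermite (q β : ℝ) : ℕ → Polynomial ℝ
  | 0 => 1
  | 1 => X
  | (n + 2) => X * qHermite q β (n + 1) - C (β * qInt q (n + 1)) * qHermite q β n

/-- The three-term recurrence of the q-Hermite polynomials, solved for the product with `X`. -/
theorem X_mul_qHermite_succ (q β : ℝ) (n : ℕ) :
    X * qHermite q β (n + 1) =
      qHermite q β (n + 2) + (β * qInt q (n + 1)) • qHermite q β n := by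
  rw [qHermite, smul_eq_C_mul, sub_add_cancel]

theorem X_mul_mem_span_qHermite (q β : ℝ) {p : ℝ[X]}
    (hp : p ∈ Submodule.span ℝ (Set.range (qHermite q β))) :
    X * p ∈ Submodule.span ℝ (Set.range (qHermite q β)) := by
  have mem (n : ℕ) : qHermite q β n ∈ Submodule.span ℝ (Set.range (qHermite q β)) :=
    Submodule.subset_span ⟨n, rfl⟩
  induction hp using Submodule.span_induction with
  | mem _ h =>
    obtain ⟨_ | n, rfl⟩ := h
    · simpa [qHermite] using mem 1
    · rw [X_mul_qHermite_succ]
      exact add_mem (mem _) (Submodule.smul_mem _ _ (mem n))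
  | zero => simp
  | add _ _ _ _ hx hy => rw [mul_add]; exact add_mem hx hy
  | smul a _ _ hx => rw [mul_smul_comm]; exact Submodule.smul_mem _ a hx

theorem span_range_qHermite (q β : ℝ) :
    Submodule.span ℝ (Set.range (qHermite q β)) = ⊤ := by
  have X_pow_mem (n : ℕ) : (X : ℝ[X]) ^ n ∈ Submodule.span ℝ (Set.range (qHermite q β)) := by
    induction n with
    | zero => exact Submodule.subset_span ⟨0, by simp [qHermite]⟩
    | succ n ih => rw [pow_succ']; exact X_mul_mem_span_qHermite q β ih
  refine (Submodule.eq_top_iff').2 fun p => ?_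
  rw [p.as_sum_range_C_mul_X_pow]
  refine Submodule.sum_mem _ fun n _ => ?_
  rw [← smul_eq_C_mul]
  exact Submodule.smul_mem _ _ (X_pow_mem n)

/-- In the q-Gaussian case, the Segal–Bargmann transform `S` (sending
`H_n^{(q)}` to `X^n`) intertwines multiplication by `x` with
`D_{q,β} + Z_q`: `S(X p) = D_{q,β}(S p) + Z_q(S p)`. -/
theorem segalBargmann_intertwines_multiplication_hermite (q β : ℝ)
    (hq0 : 0 ≤ q) (hq1 : q < 1) (hβ : 0 < β)
    (S : Polynomial ℝ →ₗ[ℝ] Polynomial ℝ)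
    (hS : ∀ n : ℕ, S (qHermite q β n) = X ^ n)
    (D : Polynomial ℝ →ₗ[ℝ] Polynomial ℝ)
    (hD0 : D 1 = 0)
    (hD : ∀ n : ℕ, D (X ^ (n + 1)) = C (β * qInt q (n + 1)) * X ^ n)
    (Z : Polynomial ℝ →ₗ[ℝ] Polynomial ℝ)
    (hZ : ∀ p : Polynomial ℝ, Z p = X * p) :
    ∀ p : Polynomial ℝ, S (X * p) = D (S p) + Z (S p) := by
  intro p
  suffices h : S ∘ₗ LinearMap.mulLeft ℝ X = D ∘ₗ S + Z ∘ₗ S by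
    simpa using LinearMap.congr_fun h p
  refine LinearMap.ext_on_range (span_range_qHermite q β) fun n => ?_
  simp only [LinearMap.comp_apply, LinearMap.add_apply, LinearMap.mulLeft_apply, hS, hZ]
  cases n with
  | zero => simpa [qHermite, hD0] using hS 1
  | succ n =>
    rw [X_mul_qHermite_succ, map_add, map_smul, hS, hS, hD, smul_eq_C_mul]
    ring
end
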